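/- Let q be a real-valued Schwartz function on ℝ and set q₊ = C₊ q. Then one has the pointwise identity C₊( H(q'') − 2 q q' ) = −i q₊'' − 2 ( C₊(q · q₊) )' + 2 q₊ · q₊', where H is the Hilbert transform. (This identifies the action of the Peter operator P = −i∂² − 2∂C₊q + 2q₊' on q₊ with the positive-frequency part of the Benjamin–Ono vector field.) -/

import Mathlib

open MeasureTheory Set ComplexConjugate

/-- Fourier transform with the convention `f̂(ξ) = (2π)^{-1/2} ∫ e^{-iξx} f(x) dx`. -/
noncomputable def FT (f : ℝ → ℂ) (ξ : ℝ) : ℂ :=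
  (Real.sqrt (2 * Real.pi))⁻¹ * ∫ x : ℝ, Complex.exp (-(Complex.I * ξ * x)) * f x

/-- Cauchy–Szegő projection `C₊`, the Fourier multiplier with symbol `1_{[0,∞)}`. -/
noncomputable def Cplus (f : ℝ → ℂ) (x : ℝ) : ℂ :=
  (Real.sqrt (2 * Real.pi))⁻¹ * ∫ ξ in Ici (0 : ℝ), Complex.exp (Complex.I * ξ * x) * FT f ξ

/-- The Hilbert transform, the Fourier multiplier with symbol `-i sgn(ξ)`. -/
noncomputable def Hilb (f : ℝ → ℂ) (x : ℝ) : ℂ :=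
  (Real.sqrt (2 * Real.pi))⁻¹ *
    ∫ ξ : ℝ, (-Complex.I * (Real.sign ξ : ℂ)) * Complex.exp (Complex.I * ξ * x) * FT f ξ

open scoped FourierTransform SchwartzMap

/-- Inverse Fourier transform with the convention matching `FT`. -/
noncomputable def IFT (g : ℝ → ℂ) (x : ℝ) : ℂ :=
  (Real.sqrt (2 * Real.pi))⁻¹ * ∫ ξ : ℝ, Complex.exp (Complex.I * ξ * x) * g ξ

/-- The unnormalised Fourier integral over the half-line of positive frequencies. -/
noncomputable def halfLineIntegral (φ : ℝ → ℂ) (x : ℝ) : ℂ :=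
  ∫ ξ in Ioi (0 : ℝ), Complex.exp (Complex.I * ξ * x) * φ ξ

lemma norm_exp_I_mul_mul (ξ x : ℝ) : ‖Complex.exp (Complex.I * ξ * x)‖ = 1 := by
  rw [mul_assoc, ← Complex.ofReal_mul]
  exact Complex.norm_exp_I_mul_ofReal _

lemma sq_inv_sqrt_two_pi_mul :
    ((Real.sqrt (2 * Real.pi) : ℂ))⁻¹ * ((Real.sqrt (2 * Real.pi) : ℂ))⁻¹ * (2 * Real.pi) = 1 := by
  have h : ((Real.sqrt (2 * Real.pi) : ℂ)) * (Real.sqrt (2 * Real.pi) : ℂ) = 2 * Real.pi := by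
    rw [← Complex.ofReal_mul, Real.mul_self_sqrt (by positivity)]
    push_cast
    ring
  have h0 : (2 * Real.pi : ℂ) ≠ 0 := by
    simp [Real.pi_ne_zero]
  rw [← mul_inv, h, inv_mul_cancel₀ h0]

lemma FT_eq_fourier (f : ℝ → ℂ) (ξ : ℝ) :
    FT f ξ = (Real.sqrt (2 * Real.pi) : ℂ)⁻¹ * 𝓕 f (ξ / (2 * Real.pi)) := by
  rw [FT, Real.fourier_real_eq_integral_exp_smul, Complex.ofReal_inv]
  congr 2 with x
  rw [smul_eq_mul]
  congr 2
  have : (Real.pi : ℂ) ≠ 0 := by simp [Real.pi_ne_zero]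
  push_cast
  field_simp

lemma IFT_eq_FT_neg (g : ℝ → ℂ) (x : ℝ) : IFT g x = FT g (-x) := by
  rw [IFT, FT]
  congr 2 with ξ
  congr 2
  push_cast
  ring

lemma IFT_eq_fourierInv (g : ℝ → ℂ) (x : ℝ) :
    IFT g x = (Real.sqrt (2 * Real.pi) : ℂ)⁻¹ * 𝓕⁻ g (x / (2 * Real.pi)) := by
  rw [IFT_eq_FT_neg, FT_eq_fourier, Real.fourierInv_eq_fourier_neg, neg_div]

/-- Fourier inversion at a point of continuity, in the normalisation of `FT`. -/
lemma FT_IFT {g : ℝ → ℂ} (hg : Integrable g) (h : Integrable (IFT g)) {ξ : ℝ}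
    (hc : ContinuousAt g ξ) : FT (IFT g) ξ = g ξ := by
  have hpi : (2 * Real.pi : ℝ) ≠ 0 := by positivity
  have hs : (Real.sqrt (2 * Real.pi) : ℂ) ≠ 0 := by
    simp [Real.sqrt_eq_zero', Real.pi_pos]
  have hfun : 𝓕⁻ g = fun u => (Real.sqrt (2 * Real.pi) : ℂ) * IFT g (u * (2 * Real.pi)) := by
    ext u
    rw [IFT_eq_fourierInv, mul_div_cancel_right₀ _ hpi, mul_inv_cancel_left₀ hs]
  have hint : Integrable (𝓕⁻ g) := by
    rw [hfun]
    exact (h.comp_mul_right' hpi).const_mul _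
  have hint' : Integrable (𝓕 g) := by
    have := hint.comp_neg
    simpa [Real.fourierInv_eq_fourier_neg] using this
  have key := hg.fourier_fourierInv_eq hint' hc
  rw [← key, Real.fourier_real_eq_integral_exp_smul, FT]
  have := Measure.integral_comp_div
    (fun v : ℝ => Complex.exp (↑(-2 * Real.pi * v * ξ) * Complex.I) • 𝓕⁻ g v) (2 * Real.pi)
  rw [abs_of_pos (by positivity), Complex.real_smul] at this
  have h2 : (fun x : ℝ => Complex.exp (-(Complex.I * ξ * x)) * IFT g x) = fun x =>
      (Real.sqrt (2 * Real.pi) : ℂ)⁻¹ * (Complex.exp (↑(-2 * Real.pi * (x / (2 * Real.pi)) * ξ)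
        * Complex.I) • 𝓕⁻ g (x / (2 * Real.pi))) := by
    ext x
    rw [IFT_eq_fourierInv, smul_eq_mul]
    rw [show ((-2 * Real.pi * (x / (2 * Real.pi)) * ξ : ℝ) : ℂ) * Complex.I =
      -(Complex.I * ξ * x) by
        rw [show (-2 * Real.pi * (x / (2 * Real.pi)) * ξ : ℝ) = - (ξ * x) by field_simp]
        push_cast
        ring]
    ring
  rw [h2, integral_const_mul, this, ← mul_assoc, ← mul_assoc]
  push_cast
  rw [sq_inv_sqrt_two_pi_mul, one_mul]

/-- The Fourier transform of a Schwartz function is a Schwartz function. -/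
lemma exists_schwartz_FT (f : 𝓢(ℝ, ℂ)) : ∃ F : 𝓢(ℝ, ℂ), FT f = F := by
  let e : ℝ ≃L[ℝ] ℝ := ContinuousLinearEquiv.unitsEquivAut ℝ
    (Units.mk0 (2 * Real.pi)⁻¹ (by positivity))
  refine ⟨(Real.sqrt (2 * Real.pi) : ℂ)⁻¹ •
    SchwartzMap.compCLMOfContinuousLinearEquiv ℂ e (𝓕 f), ?_⟩
  ext ξ
  rw [FT_eq_fourier]
  simp [e, SchwartzMap.fourier_coe, div_eq_mul_inv]

lemma IFT_FT (f : 𝓢(ℝ, ℂ)) : IFT (FT f) = f := by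
  obtain ⟨r, hr⟩ : ∃ r : 𝓢(ℝ, ℂ), ∀ x, r x = f (-x) :=
    ⟨SchwartzMap.compCLMOfContinuousLinearEquiv ℂ (ContinuousLinearEquiv.neg ℝ) f, fun x => by simp⟩
  have h : FT f = IFT r := by
    ext ξ
    rw [FT, IFT, ← integral_neg_eq_self]
    congr 2 with x
    rw [hr, mul_right_comm]
    simp
  obtain ⟨F, hF⟩ := exists_schwartz_FT f
  ext x
  rw [IFT_eq_FT_neg, h, FT_IFT r.integrable (by rw [← h, hF]; exact F.integrable)
    r.continuous.continuousAt, hr, neg_neg]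

lemma FT_deriv (f : 𝓢(ℝ, ℂ)) (ξ : ℝ) : FT (deriv f) ξ = Complex.I * ξ * FT f ξ := by
  have hd : Integrable (deriv f) := (SchwartzMap.derivCLM ℂ ℂ f).integrable
  rw [FT_eq_fourier, FT_eq_fourier, Real.fourier_deriv f.integrable f.differentiable hd]
  have : (Real.pi : ℂ) ≠ 0 := by simp [Real.pi_ne_zero]
  simp only [smul_eq_mul]
  push_cast
  field_simp

lemma Cplus_eq (f : ℝ → ℂ) (x : ℝ) :
    Cplus f x = (Real.sqrt (2 * Real.pi) : ℂ)⁻¹ * halfLineIntegral (FT f) x := by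
  rw [Cplus, halfLineIntegral, integral_Ici_eq_integral_Ioi, Complex.ofReal_inv]

lemma integrable_exp_mul {φ : ℝ → ℂ} {μ : Measure ℝ} (h : Integrable φ μ) (x : ℝ) :
    Integrable (fun ξ : ℝ => Complex.exp (Complex.I * ξ * x) * φ ξ) μ :=
  h.bdd_mul (c := 1) (by fun_prop) (by simp [norm_exp_I_mul_mul])

lemma hasDerivAt_halfLineIntegral {φ : ℝ → ℂ} (h : Integrable φ)
    (h' : Integrable (fun ξ : ℝ => Complex.I * ξ * φ ξ)) (x : ℝ) :
    HasDerivAt (halfLineIntegral φ) (halfLineIntegral (fun ξ => Complex.I * ξ * φ ξ) x) x := by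
  refine (hasDerivAt_integral_of_dominated_loc_of_deriv_le (s := univ)
    (F' := fun (y : ℝ) (ξ : ℝ) => Complex.exp (Complex.I * ξ * y) * (Complex.I * ξ * φ ξ))
    (bound := fun ξ : ℝ => ‖Complex.I * ξ * φ ξ‖) Filter.univ_mem
    (.of_forall fun y => (integrable_exp_mul h.integrableOn y).aestronglyMeasurable)
    (integrable_exp_mul h.integrableOn x)
    (integrable_exp_mul h'.integrableOn x).aestronglyMeasurable
    (.of_forall fun ξ y _ => ?_) h'.integrableOn.norm (.of_forall fun ξ y _ => ?_)).2
  · rw [norm_mul, norm_exp_I_mul_mul, one_mul]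
  · have h1 : HasDerivAt (fun y : ℝ => Complex.I * ξ * (y : ℂ)) (Complex.I * ξ) y := by
      simpa using (Complex.ofRealCLM.hasDerivAt (x := y)).const_mul (Complex.I * ξ)
    convert! (h1.cexp).mul_const (φ ξ) using 1
    ring

lemma hasDerivAt_Cplus (f : 𝓢(ℝ, ℂ)) (x : ℝ) : HasDerivAt (Cplus f) (Cplus (deriv f) x) x := by
  obtain ⟨F, hF⟩ := exists_schwartz_FT f
  obtain ⟨F', hF'⟩ := exists_schwartz_FT (SchwartzMap.derivCLM ℂ ℂ f)
  have e : FT (deriv f) = fun ξ : ℝ => Complex.I * ξ * FT f ξ := funext (FT_deriv f)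
  have e' : FT (deriv f) = F' := hF'
  rw [Cplus_eq, e]
  refine HasDerivAt.congr_of_eventuallyEq ?_ (.of_forall (Cplus_eq f))
  refine (hasDerivAt_halfLineIntegral (hF ▸ F.integrable) ?_ x).const_mul _
  rw [← e, e']
  exact F'.integrable

/-- One integration by parts in the half-line Fourier integral. -/
lemma halfLineIntegral_deriv (φ : 𝓢(ℝ, ℂ)) (h0 : φ 0 = 0) (x : ℝ) :
    halfLineIntegral (deriv φ) x = -(Complex.I * x) * halfLineIntegral φ x := by
  have hd : Integrable (deriv φ) := (SchwartzMap.derivCLM ℂ ℂ φ).integrable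
  have i1 := integrable_exp_mul (μ := volume.restrict (Ioi 0)) φ.integrable.integrableOn x
  have i2 := integrable_exp_mul (μ := volume.restrict (Ioi 0)) hd.integrableOn x
  have key := integral_Ioi_of_hasDerivAt_of_tendsto' (a := (0 : ℝ)) (m := (0 : ℂ))
    (f := fun ξ : ℝ => Complex.exp (Complex.I * ξ * x) * φ ξ)
    (f' := fun ξ : ℝ => Complex.I * x * (Complex.exp (Complex.I * ξ * x) * φ ξ) +
      Complex.exp (Complex.I * ξ * x) * deriv φ ξ) ?_ ?_ ?_
  · rw [integral_add (i1.const_mul _) i2, integral_const_mul, h0] at key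
    simp only [mul_zero, sub_zero] at key
    rw [halfLineIntegral, halfLineIntegral]
    linear_combination key
  · intro ξ _
    have h1 : HasDerivAt (fun ξ : ℝ => Complex.I * (ξ : ℂ) * x) (Complex.I * x) ξ := by
      simpa using ((Complex.ofRealCLM.hasDerivAt (x := ξ)).const_mul Complex.I).mul_const (x : ℂ)
    convert! h1.cexp.mul (φ.differentiableAt.hasDerivAt) using 1
    ring
  · exact (i1.const_mul _).add i2
  · have := φ.tendsto_cocompact.mono_left (atTop_le_cocompact)
    refine squeeze_zero_norm (fun ξ => ?_) (tendsto_zero_iff_norm_tendsto_zero.1 this)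
    rw [norm_mul, norm_exp_I_mul_mul, one_mul]

lemma norm_halfLineIntegral_le (φ : ℝ → ℂ) (x : ℝ) :
    ‖halfLineIntegral φ x‖ ≤ ∫ ξ in Ioi (0 : ℝ), ‖φ ξ‖ := by
  refine (norm_integral_le_integral_norm _).trans_eq ?_
  simp only [norm_mul, norm_exp_I_mul_mul, one_mul]

lemma continuous_halfLineIntegral {φ : ℝ → ℂ} (h : Integrable φ) :
    Continuous (halfLineIntegral φ) := by
  refine continuous_of_dominated (bound := fun ξ => ‖φ ξ‖)
    (fun x => (integrable_exp_mul h.integrableOn x).aestronglyMeasurable)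
    (fun x => .of_forall fun ξ => ?_) h.integrableOn.norm (.of_forall fun ξ => by fun_prop)
  rw [norm_mul, norm_exp_I_mul_mul, one_mul]

lemma integrable_halfLineIntegral (φ : 𝓢(ℝ, ℂ)) (h0 : φ 0 = 0) (h1 : deriv φ 0 = 0) :
    Integrable (halfLineIntegral φ) := by
  set D := SchwartzMap.derivCLM ℂ ℂ φ
  refine Integrable.mono' (integrable_inv_one_add_sq.const_mul
    ((∫ ξ in Ioi (0 : ℝ), ‖φ ξ‖) + ∫ ξ in Ioi (0 : ℝ), ‖deriv D ξ‖))
    (continuous_halfLineIntegral φ.integrable).aestronglyMeasurable (.of_forall fun x => ?_)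
  have e : halfLineIntegral (deriv D) x = -((x : ℂ) ^ 2) * halfLineIntegral φ x := by
    rw [halfLineIntegral_deriv D h1, show ⇑D = deriv φ from rfl, halfLineIntegral_deriv φ h0]
    linear_combination (x : ℂ) ^ 2 * halfLineIntegral φ x * Complex.I_sq
  have b := norm_halfLineIntegral_le (deriv D) x
  rw [e, norm_mul, norm_neg, norm_pow, Complex.norm_real, Real.norm_eq_abs, sq_abs] at b
  rw [← div_eq_mul_inv, le_div_iff₀ (by positivity)]
  linarith [norm_halfLineIntegral_le φ x]

lemma Hilb_eq_IFT (f : ℝ → ℂ) :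
    Hilb f = IFT (fun ξ => -Complex.I * (Real.sign ξ : ℂ) * FT f ξ) := by
  ext x
  rw [Hilb, IFT]
  congr 2 with ξ
  ring

lemma IFT_sign_mul (F G : 𝓢(ℝ, ℂ)) (h0 : F 0 = 0) (hG : ∀ x, G x = F (-x)) (x : ℝ) :
    IFT (fun ξ => -Complex.I * (Real.sign ξ : ℂ) * F ξ) x =
      (Real.sqrt (2 * Real.pi) : ℂ)⁻¹ *
        (-Complex.I * (halfLineIntegral F x - halfLineIntegral G (-x))) := by
  have e : (fun ξ : ℝ => Complex.exp (Complex.I * ξ * x) *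
      (-Complex.I * (Real.sign ξ : ℂ) * F ξ)) = (Ioi (0 : ℝ)).piecewise
      (fun ξ => -Complex.I * (Complex.exp (Complex.I * ξ * x) * F ξ))
      (fun ξ => Complex.I * (Complex.exp (Complex.I * ξ * x) * F ξ)) := by
    ext ξ
    rcases lt_trichotomy ξ 0 with h | rfl | h
    · rw [piecewise_eq_of_notMem _ _ _ (by simpa using h.le), Real.sign_of_neg h]
      push_cast
      ring
    · simp [h0]
    · rw [piecewise_eq_of_mem _ _ _ (mem_Ioi.2 h), Real.sign_of_pos h]
      push_cast
      ring
  have i := integrable_exp_mul (F.integrable (μ := volume)) x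
  rw [IFT, e, integral_piecewise measurableSet_Ioi (i.const_mul _).integrableOn
    (i.const_mul _).integrableOn, compl_Ioi, integral_const_mul, integral_const_mul,
    Complex.ofReal_inv, halfLineIntegral, halfLineIntegral]
  have e2 := integral_comp_neg_Ioi 0 (fun ξ : ℝ => Complex.exp (Complex.I * ξ * x) * F ξ)
  rw [neg_zero] at e2
  rw [← e2]
  simp only [hG, Complex.ofReal_neg, mul_neg, neg_mul]
  ring

/-- The Hilbert transform of a Schwartz function whose Fourier transform vanishes to second order
at the origin is integrable. -/
lemma integrable_Hilb {f : 𝓢(ℝ, ℂ)} (h0 : FT f 0 = 0) (h1 : deriv (FT f) 0 = 0) :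
    Integrable (Hilb f) := by
  obtain ⟨F, hF⟩ := exists_schwartz_FT f
  obtain ⟨G, hG⟩ : ∃ G : 𝓢(ℝ, ℂ), ∀ x, G x = F (-x) :=
    ⟨SchwartzMap.compCLMOfContinuousLinearEquiv ℂ (ContinuousLinearEquiv.neg ℝ) F, fun x => by simp⟩
  rw [hF] at h0 h1
  have hG1 : deriv G 0 = 0 := by
    rw [show ⇑G = fun x => F (-x) from funext hG, deriv_comp_neg, neg_zero, h1, neg_zero]
  rw [Hilb_eq_IFT, hF, funext (IFT_sign_mul F G h0 hG)]
  exact (((integrable_halfLineIntegral F h0 h1).sub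
    (integrable_halfLineIntegral G (by simp [hG, h0]) hG1).comp_neg).const_mul _).const_mul _

lemma FT_Hilb {f : 𝓢(ℝ, ℂ)} (h0 : FT f 0 = 0) (h1 : deriv (FT f) 0 = 0) {ξ : ℝ} (hξ : 0 < ξ) :
    FT (Hilb f) ξ = -Complex.I * FT f ξ := by
  have hi := integrable_Hilb h0 h1
  obtain ⟨F, hF⟩ := exists_schwartz_FT f
  rw [Hilb_eq_IFT] at hi ⊢
  have hsm : Measurable Real.sign := by
    unfold Real.sign
    exact Measurable.ite measurableSet_Iio measurable_const
      (Measurable.ite measurableSet_Ioi measurable_const measurable_const)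
  rw [FT_IFT _ hi, Real.sign_of_pos hξ]
  · simp
  · have : (fun η => -Complex.I * (Real.sign η : ℂ) * FT f η) =ᶠ[nhds ξ]
        fun η => -Complex.I * F η := by
      filter_upwards [lt_mem_nhds hξ] with η hη
      rw [Real.sign_of_pos hη, hF]
      simp
    exact ContinuousAt.congr (by fun_prop) this.symm
  · rw [hF]
    refine F.integrable.bdd_mul (c := 1) (by fun_prop) (.of_forall fun η => ?_)
    rcases Real.sign_apply_eq η with h | h | h <;> simp [h]

/-- The Fourier transform turns products into convolutions. -/
lemma FT_mul_IFT (q : 𝓢(ℝ, ℂ)) {φ : ℝ → ℂ} (hφ : Integrable φ) (ξ : ℝ) :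
    FT (fun y => q y * IFT φ y) ξ =
      (Real.sqrt (2 * Real.pi) : ℂ)⁻¹ * ∫ η, φ η * FT q (ξ - η) := by
  rw [FT, Complex.ofReal_inv]
  congr 1
  set c := (Real.sqrt (2 * Real.pi) : ℂ)⁻¹ with hc
  have e1 : (fun x : ℝ => Complex.exp (-(Complex.I * ξ * x)) * (q x * IFT φ x)) = fun x : ℝ =>
      ∫ η : ℝ, c * (Complex.exp (-(Complex.I * (ξ - η) * x)) * (q x * φ η)) := by
    ext x
    rw [integral_const_mul, IFT, Complex.ofReal_inv, ← hc]
    have : (fun η : ℝ => Complex.exp (-(Complex.I * (ξ - η) * x)) * (q x * φ η)) = fun η : ℝ =>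
        (Complex.exp (-(Complex.I * ξ * x)) * q x) * (Complex.exp (Complex.I * η * x) * φ η) := by
      ext η
      rw [show -(Complex.I * (ξ - η) * x) = -(Complex.I * ξ * x) + Complex.I * η * x by ring,
        Complex.exp_add]
      ring
    rw [this, integral_const_mul]
    ring
  rw [e1, integral_integral_swap]
  · congr 1 with η
    rw [FT, integral_const_mul, Complex.ofReal_inv, ← hc]
    have : (fun x : ℝ => Complex.exp (-(Complex.I * (ξ - η) * x)) * (q x * φ η)) = fun x : ℝ =>
        φ η * (Complex.exp (-(Complex.I * ((ξ - η : ℝ) : ℂ) * x)) * q x) := by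
      ext x
      push_cast
      ring
    rw [this, integral_const_mul]
    ring
  · refine Integrable.const_mul ?_ _
    refine (q.integrable.mul_prod hφ).bdd_mul (c := 1) (by fun_prop) (.of_forall fun p => ?_)
    rw [show -(Complex.I * (ξ - (p.2 : ℂ)) * p.1) = Complex.I * ((p.2 - ξ : ℝ) : ℂ) * p.1 by
      push_cast
      ring, norm_exp_I_mul_mul]

/-- The positive-frequency part of the Fourier transform. -/
noncomputable def posFT (f : ℝ → ℂ) : ℝ → ℂ := (Ioi (0 : ℝ)).indicator (FT f)

lemma integrable_posFT (f : 𝓢(ℝ, ℂ)) : Integrable (posFT f) := by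
  obtain ⟨F, hF⟩ := exists_schwartz_FT f
  rw [posFT, hF]
  exact F.integrable.indicator measurableSet_Ioi

lemma Cplus_eq_IFT (f : ℝ → ℂ) : Cplus f = IFT (posFT f) := by
  ext x
  rw [Cplus_eq, halfLineIntegral, IFT, Complex.ofReal_inv, ← integral_indicator measurableSet_Ioi]
  congr 2 with ξ
  rw [posFT, indicator_mul_right]

/-- On positive frequencies, `q ^ 2 - 2 q q₊` and `-q₊ ^ 2` have the same Fourier transform. -/
lemma two_mul_FT_mul_Cplus (q : 𝓢(ℝ, ℂ)) {ξ : ℝ} (hξ : 0 < ξ) :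
    2 * FT (fun y => q y * Cplus q y) ξ = FT (fun y => q y * q y) ξ +
      (Real.sqrt (2 * Real.pi) : ℂ)⁻¹ * ∫ η, posFT q η * posFT q (ξ - η) := by
  obtain ⟨F, hF⟩ := exists_schwartz_FT q
  have ha := integrable_posFT q
  have e1 : FT (fun y => q y * q y) ξ =
      (Real.sqrt (2 * Real.pi) : ℂ)⁻¹ * ∫ η, F η * F (ξ - η) := by
    have := FT_mul_IFT q (hF ▸ F.integrable) ξ
    rwa [IFT_FT, hF] at this
  have e2 : FT (fun y => q y * Cplus q y) ξ =
      (Real.sqrt (2 * Real.pi) : ℂ)⁻¹ * ∫ η, posFT q η * F (ξ - η) := by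
    rw [Cplus_eq_IFT, FT_mul_IFT q ha, hF]
  have e3 : ∫ η, posFT q η * F (ξ - η) = ∫ η, F η * posFT q (ξ - η) := by
    rw [← integral_sub_left_eq_self _ _ ξ]
    congr 1 with η
    rw [sub_sub_cancel, mul_comm]
  have hb : ∀ x, ‖F x‖ ≤ SchwartzMap.seminorm ℝ 0 0 F := SchwartzMap.norm_le_seminorm ℝ F
  have i1 : Integrable fun η => F η * F (ξ - η) :=
    (F.integrable.comp_sub_left ξ).bdd_mul F.continuous.aestronglyMeasurable (.of_forall hb)
  have i2 : Integrable fun η => posFT q η * F (ξ - η) :=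
    ha.mul_bdd (F.continuous.comp (by fun_prop)).aestronglyMeasurable (.of_forall fun η => hb _)
  have i3 : Integrable fun η => F η * posFT q (ξ - η) :=
    (ha.comp_sub_left ξ).bdd_mul F.continuous.aestronglyMeasurable (.of_forall hb)
  have i4 : Integrable fun η => posFT q η * posFT q (ξ - η) := by
    refine (ha.comp_sub_left ξ).bdd_mul (c := SchwartzMap.seminorm ℝ 0 0 F)
      ha.aestronglyMeasurable (.of_forall fun η => ?_)
    rw [posFT, hF]
    exact (norm_indicator_le_norm_self _ _).trans (hb η)
  have key : (fun η => F η * F (ξ - η) - posFT q η * F (ξ - η) - F η * posFT q (ξ - η) +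
      posFT q η * posFT q (ξ - η)) = fun _ => 0 := by
    ext η
    have : F η - posFT q η = 0 ∨ F (ξ - η) - posFT q (ξ - η) = 0 := by
      rw [posFT, hF]
      rcases lt_or_ge 0 η with h | h
      · exact .inl (by rw [indicator_of_mem (mem_Ioi.2 h), sub_self])
      · exact .inr (by rw [indicator_of_mem (show ξ - η ∈ Ioi 0 by simpa using h.trans_lt hξ),
          sub_self])
    linear_combination mul_eq_zero.2 this
  have key' := congrArg (fun g : ℝ → ℂ => ∫ η, g η) key
  simp only [integral_zero] at key'
  rw [integral_add (by exact (i1.sub i2).sub i3) i4, integral_sub (by exact i1.sub i2) i3, integral_sub i1 i2,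
    ← e3] at key'
  rw [e1, e2]
  linear_combination -(Real.sqrt (2 * Real.pi) : ℂ)⁻¹ * key'

lemma halfLineIntegral_posFT_convolution (f : 𝓢(ℝ, ℂ)) (x : ℝ) :
    IntegrableOn (fun ξ : ℝ => Complex.exp (Complex.I * ξ * x) *
      ∫ η, posFT f η * posFT f (ξ - η)) (Ioi 0) ∧
    halfLineIntegral (fun ξ => ∫ η, posFT f η * posFT f (ξ - η)) x =
      halfLineIntegral (FT f) x ^ 2 := by
  set a : ℝ → ℂ := fun ξ => Complex.exp (Complex.I * ξ * x) * posFT f ξ with ha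
  have ia : Integrable a := integrable_exp_mul (integrable_posFT f) x
  have hconv : convolution a a (ContinuousLinearMap.mul ℂ ℂ) volume = fun ξ : ℝ =>
      Complex.exp (Complex.I * ξ * x) * ∫ η, posFT f η * posFT f (ξ - η) := by
    ext ξ
    rw [convolution_def, ← integral_const_mul]
    congr 1 with η
    simp only [ha, ContinuousLinearMap.mul_apply']
    rw [show Complex.I * ξ * x = Complex.I * η * x + Complex.I * ((ξ - η : ℝ) : ℂ) * x by
      push_cast
      ring, Complex.exp_add]
    ring
  have hint := ia.integrable_convolution (ContinuousLinearMap.mul ℂ ℂ) ia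
  have hval := integral_convolution (ContinuousLinearMap.mul ℂ ℂ) ia ia
  rw [hconv] at hint hval
  refine ⟨hint.integrableOn, ?_⟩
  have hsupp : ∀ ξ ∉ Ioi (0 : ℝ), Complex.exp (Complex.I * ξ * x) *
      ∫ η, posFT f η * posFT f (ξ - η) = 0 := by
    intro ξ hξ
    have : ∀ η, posFT f η * posFT f (ξ - η) = 0 := fun η => by
      rw [posFT]
      rcases lt_or_ge 0 η with h | h
      · rw [indicator_of_notMem (a := ξ - η), mul_zero]
        simp only [mem_Ioi, not_lt] at hξ ⊢
        linarith
      · rw [indicator_of_notMem (by simpa using h), zero_mul]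
    simp [this]
  have hhalf : ∫ ξ, a ξ = halfLineIntegral (FT f) x := by
    rw [halfLineIntegral, ← integral_indicator measurableSet_Ioi]
    congr 1 with ξ
    simp only [ha]
    rw [posFT, indicator_mul_right]
  rw [halfLineIntegral, setIntegral_eq_integral_of_forall_compl_eq_zero hsupp, hval, hhalf,
    ContinuousLinearMap.mul_apply', sq]

/-- `C₊ (q q₊) = (C₊ (q ^ 2) + q₊ ^ 2) / 2`, where `q₊ = C₊ q`. -/
lemma Cplus_mul_Cplus (q P : 𝓢(ℝ, ℂ)) (hP : ∀ x, P x = q x * q x) (x : ℝ) :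
    Cplus (fun z => q z * Cplus q z) x = 2⁻¹ * (Cplus P x + Cplus q x ^ 2) := by
  obtain ⟨hi, hv⟩ := halfLineIntegral_posFT_convolution q x
  obtain ⟨R, hR⟩ := exists_schwartz_FT P
  have iR := integrable_exp_mul (hR ▸ R.integrable.integrableOn :
    IntegrableOn (FT P) (Ioi 0)) x
  have e : halfLineIntegral (FT fun z => q z * Cplus q z) x = 2⁻¹ * (halfLineIntegral (FT P) x +
      (Real.sqrt (2 * Real.pi) : ℂ)⁻¹ *
        halfLineIntegral (fun ξ => ∫ η, posFT q η * posFT q (ξ - η)) x) := by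
    simp only [halfLineIntegral]
    rw [← integral_const_mul (Real.sqrt (2 * Real.pi) : ℂ)⁻¹,
      ← integral_add iR (hi.const_mul _), ← integral_const_mul]
    refine setIntegral_congr_fun measurableSet_Ioi fun ξ hξ => ?_
    have := two_mul_FT_mul_Cplus q hξ
    rw [← funext hP] at this
    linear_combination 2⁻¹ * Complex.exp (Complex.I * ξ * x) * this
  rw [Cplus_eq, e, hv, Cplus_eq, Cplus_eq]
  ring

/-- `C₊ H = -i C₊` on Schwartz functions whose Fourier transform vanishes to second order at the
origin, up to a Schwartz perturbation. -/
lemma Cplus_Hilb_sub {f : 𝓢(ℝ, ℂ)} (h0 : FT f 0 = 0) (h1 : deriv (FT f) 0 = 0) (g : 𝓢(ℝ, ℂ))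
    (x : ℝ) : Cplus (fun y => Hilb f y - g y) x = -Complex.I * Cplus f x - Cplus g x := by
  obtain ⟨F, hF⟩ := exists_schwartz_FT f
  obtain ⟨G, hG⟩ := exists_schwartz_FT g
  have hsub (ξ : ℝ) : FT (fun y => Hilb f y - g y) ξ = FT (Hilb f) ξ - FT g ξ := by
    have b {u : ℝ → ℂ} (hu : Integrable u) :
        Integrable fun y : ℝ => Complex.exp (-(Complex.I * ξ * y)) * u y := by
      simpa [mul_right_comm] using integrable_exp_mul hu (-ξ)
    simp only [FT, mul_sub]
    rw [integral_sub (b (integrable_Hilb h0 h1)) (b g.integrable), mul_sub]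
  have e : halfLineIntegral (FT fun y => Hilb f y - g y) x =
      -Complex.I * halfLineIntegral (FT f) x - halfLineIntegral (FT g) x := by
    have iF := integrable_exp_mul (hF ▸ F.integrable.integrableOn : IntegrableOn (FT f) (Ioi 0)) x
    have iG := integrable_exp_mul (hG ▸ G.integrable.integrableOn : IntegrableOn (FT g) (Ioi 0)) x
    simp only [halfLineIntegral]
    rw [← integral_const_mul, ← integral_sub (iF.const_mul _) iG]
    refine setIntegral_congr_fun measurableSet_Ioi fun ξ hξ => ?_
    simp only [hsub, FT_Hilb h0 h1 hξ]
    ring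
  rw [Cplus_eq, e, Cplus_eq, Cplus_eq]
  ring

/-- `C₊(H q'' - 2 q q') = -i q₊'' - 2 (C₊(q q₊))' + 2 q₊ q₊'` pointwise,
where `q₊ = C₊ q`. -/
theorem stmt13 (q : SchwartzMap ℝ ℂ) (hq : ∀ x : ℝ, (q x).im = 0) :
    ∀ x : ℝ,
      Cplus (fun y => Hilb (fun z => deriv (deriv (⇑q)) z) y - 2 * q y * deriv (⇑q) y) x
        = -Complex.I * deriv (fun y => deriv (fun z => Cplus (⇑q) z) y) x
          - 2 * deriv (fun y => Cplus (fun z => q z * Cplus (⇑q) z) y) x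
          + 2 * Cplus (⇑q) x * deriv (fun y => Cplus (⇑q) y) x := by
  intro x
  let q' : SchwartzMap ℝ ℂ := SchwartzMap.derivCLM ℂ ℂ q
  let q'' : SchwartzMap ℝ ℂ := SchwartzMap.derivCLM ℂ ℂ q'
  let P : SchwartzMap ℝ ℂ := SchwartzMap.smulLeftCLM ℂ q q
  have hP : ∀ y, P y = q y * q y := fun y => by
    simp [P, SchwartzMap.smulLeftCLM_apply_apply q.hasTemperateGrowth]
  have hP' : deriv P = fun y => 2 * q y * deriv q y := by
    ext y
    rw [show ⇑P = fun y => q y * q y from funext hP]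
    have h := (q.differentiableAt (x := y)).hasDerivAt
    rw [(h.fun_mul h).deriv]
    ring
  obtain ⟨R, hR⟩ := exists_schwartz_FT q'
  have hR0 : R 0 = 0 := by
    rw [← hR, show ⇑q' = deriv q from rfl, FT_deriv]
    simp
  have hF : FT q'' = fun ξ : ℝ => Complex.I * ξ * R ξ := by
    ext ξ
    rw [show ⇑q'' = deriv q' from rfl, FT_deriv, hR]
  have h0 : FT q'' 0 = 0 := by simp [hF]
  have h1 : deriv (FT q'') 0 = 0 := by
    have hI : HasDerivAt (fun ξ : ℝ => Complex.I * (ξ : ℂ)) Complex.I 0 := by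
      simpa using (Complex.ofRealCLM.hasDerivAt (x := (0 : ℝ))).const_mul Complex.I
    rw [hF, (hI.fun_mul (R.differentiableAt (x := 0)).hasDerivAt).deriv, hR0]
    simp
  have hL := Cplus_Hilb_sub h0 h1 (SchwartzMap.derivCLM ℂ ℂ P) x
  rw [show ⇑(SchwartzMap.derivCLM ℂ ℂ P) = deriv P from rfl] at hL
  have hC1 : deriv (Cplus q) = Cplus q' := funext fun y => (hasDerivAt_Cplus q y).deriv
  have hC2 : deriv (Cplus q') x = Cplus q'' x := (hasDerivAt_Cplus q' x).deriv
  have hM : deriv (fun y => Cplus (fun z => q z * Cplus (⇑q) z) y) x =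
      2⁻¹ * (Cplus (deriv P) x + 2 * Cplus q x * Cplus q' x) := by
    rw [funext (Cplus_mul_Cplus q P hP)]
    have h := (((hasDerivAt_Cplus P x).fun_add ((hasDerivAt_Cplus q x).fun_pow 2)).const_mul
      (2⁻¹ : ℂ)).deriv
    rw [h, show ⇑q' = deriv q from rfl]
    simp
  calc _ = -Complex.I * Cplus q'' x - Cplus (deriv P) x := by
        rw [← hL, hP']
        rfl
    _ = _ := by
        rw [hM]
        simp only [hC1, hC2]
        ring
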